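/- Let K := {e⁽¹⁾, e⁽²⁾, e⁽³⁾} be the hexagonal-to-rhombic wells. There exists a constant γ ∈ (0,1) with the following property: for every M ∈ ℝ^{2×2} with e(M) ∈ int conv(K), setting d₀ := dist(e(M), K), there exist a diamond-shaped (parallelogram) domain Ω_δ(M) ⊂ ℝ² and a piecewise affine Lipschitz map w : Ω_δ(M) → ℝ² such that (i) dist(e(∇w), K) ≤ γ·d₀ a.e. in Ω_δ(M), and (ii) w(x) = Mx on ∂Ω_δ(M). -/

import Mathlib

noncomputable section
open MeasureTheory Set
open scoped Matrix

abbrev Euc2 := EuclideanSpace ℝ (Fin 2)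

/-- The hexagonal-to-rhombic wells `e⁽¹⁾, e⁽²⁾, e⁽³⁾`. -/
def hexWells : Fin 3 → Matrix (Fin 2) (Fin 2) ℝ :=
  ![!![1, 0; 0, -1],
    (1/2 : ℝ) • !![-1, Real.sqrt 3; Real.sqrt 3, 1],
    (1/2 : ℝ) • !![-1, -Real.sqrt 3; -Real.sqrt 3, 1]]

/-- The set of wells `K = {e⁽¹⁾, e⁽²⁾, e⁽³⁾}`. -/
def hexK : Set (Matrix (Fin 2) (Fin 2) ℝ) := {hexWells 0, hexWells 1, hexWells 2}

/-- The symmetrised tensor product `a ⊙ n = (1/2)(a nᵀ + n aᵀ)`. -/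
def odot (a nv : Euc2) : Matrix (Fin 2) (Fin 2) ℝ :=
  fun i j => (a i * nv j + nv i * a j) / 2

/-- The symmetric part `e(M) = (1/2)(M + Mᵀ)`. -/
def symPart (M : Matrix (Fin 2) (Fin 2) ℝ) : Matrix (Fin 2) (Fin 2) ℝ :=
  (1/2 : ℝ) • (M + Mᵀ)

/-- `A` lies in the interior of the convex hull of the wells, taken within the plane of
symmetric trace-free `2×2` matrices: all barycentric coordinates are positive. -/
def inIntConv (A : Matrix (Fin 2) (Fin 2) ℝ) : Prop :=
  ∃ lam : Fin 3 → ℝ, (∀ i, 0 < lam i) ∧ (∑ i, lam i) = 1 ∧ A = ∑ i, lam i • hexWells i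

def matVec2 (M : Matrix (Fin 2) (Fin 2) ℝ) (x : Euc2) : Euc2 :=
  WithLp.toLp 2 (fun i => ∑ j, M i j * x j)

def grad2 (w : Euc2 → Euc2) (x : Euc2) : Matrix (Fin 2) (Fin 2) ℝ :=
  fun i j => fderiv ℝ w x (EuclideanSpace.single j 1) i

def fro2 (A : Matrix (Fin 2) (Fin 2) ℝ) : ℝ := Real.sqrt (∑ i, ∑ j, (A i j)^2)

def distK2 (A : Matrix (Fin 2) (Fin 2) ℝ) (K : Set (Matrix (Fin 2) (Fin 2) ℝ)) : ℝ :=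
  sInf ((fun B => fro2 (A - B)) '' K)

/-- An open parallelogram ("diamond") in the plane: the image of the open unit square
under translation and an injective linear map. -/
def IsOpenParallelogram (s : Set Euc2) : Prop :=
  ∃ (c v w : Euc2), LinearIndependent ℝ ![v, w] ∧
    s = {y | ∃ a ∈ Set.Ioo (0:ℝ) 1, ∃ b ∈ Set.Ioo (0:ℝ) 1, y = c + a • v + b • w}

/-- An open triangle in the plane. -/
def IsOpenTriangle (t : Set Euc2) : Prop :=
  ∃ p q r : Euc2, AffineIndependent ℝ ![p, q, r] ∧
    t = interior (convexHull ℝ {p, q, r})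

/-- `w` is piecewise affine on `s`: up to a null set, `s` is partitioned into finitely
many open triangles on each of which `w` is affine. -/
def IsPiecewiseAffineOn (w : Euc2 → Euc2) (s : Set Euc2) : Prop :=
  ∃ (m : ℕ) (T : Fin m → Set Euc2),
    (∀ k, IsOpenTriangle (T k)) ∧ (∀ k, T k ⊆ s) ∧
    (∀ k l, k ≠ l → T k ∩ T l = ∅) ∧
    volume (s \ ⋃ k, T k) = 0 ∧
    ∀ k, ∃ (A : Matrix (Fin 2) (Fin 2) ℝ) (c : Euc2),
      EqOn w (fun x => matVec2 A x + c) (T k)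

set_option linter.all false

lemma tri_interior (p q r : Euc2) (h : AffineIndependent ℝ ![p, q, r]) :
    interior (convexHull ℝ {p, q, r}) =
      {x | ∃ α β γ : ℝ, 0 < α ∧ 0 < β ∧ 0 < γ ∧ α + β + γ = 1 ∧ x = α • p + β • q + γ • r} := by
  have htop : affineSpan ℝ (range ![p, q, r]) = ⊤ := by
    rw [h.affineSpan_eq_top_iff_card_eq_finrank_add_one]
    simp
  let b : AffineBasis (Fin 3) ℝ Euc2 := ⟨![p, q, r], h, htop⟩
  have hb : ∀ i, b i = ![p, q, r] i := fun i => rfl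
  have hr : ({p, q, r} : Set Euc2) = range b := by
    ext x
    simp only [mem_range, Fin.exists_fin_succ, hb]
    simp [eq_comm]
  rw [hr, b.interior_convexHull]
  ext x
  simp only [mem_setOf_eq]
  constructor
  · intro hx
    refine ⟨b.coord 0 x, b.coord 1 x, b.coord 2 x, hx 0, hx 1, hx 2, ?_, ?_⟩
    · have := b.sum_coord_apply_eq_one x
      rwa [Fin.sum_univ_three] at this
    · have := b.linear_combination_coord_eq_self x
      rw [Fin.sum_univ_three] at this
      simpa [hb] using this.symm
  · rintro ⟨α, β, γ, hα, hβ, hγ, hs, rfl⟩ i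
    have hw : ∑ i, (![α, β, γ] : Fin 3 → ℝ) i = 1 := by
      simpa [Fin.sum_univ_three] using hs
    have hc : α • p + β • q + γ • r =
        Finset.univ.affineCombination ℝ b ![α, β, γ] := by
      rw [Finset.affineCombination_eq_linear_combination _ _ _ hw, Fin.sum_univ_three]
      simp [hb]
    rw [hc, b.coord_apply_combination_of_mem (Finset.mem_univ i) hw]
    fin_cases i <;> simpa

/-- coordinates on the plane -/
structure Crd (f g : Euc2 →L[ℝ] ℝ) (V W : Euc2) : Prop where
  fV : f V = 1
  fW : f W = 0
  gV : g V = 0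
  gW : g W = 1
  rep : ∀ x, x = f x • V + g x • W

lemma Crd.swap {f g : Euc2 →L[ℝ] ℝ} {V W : Euc2} (h : Crd f g V W) : Crd g f W V :=
  ⟨h.gW, h.gV, h.fW, h.fV, fun x => by rw [add_comm]; exact h.rep x⟩

lemma Crd.ext {f g : Euc2 →L[ℝ] ℝ} {V W : Euc2} (h : Crd f g V W) {x y : Euc2}
    (h1 : f x = f y) (h2 : g x = g y) : x = y := by
  rw [h.rep x, h.rep y, h1, h2]

lemma aff_indep {f g : Euc2 →L[ℝ] ℝ} (p q r : Euc2)
    (hd : (f q - f p) * (g r - g p) - (f r - f p) * (g q - g p) ≠ 0) :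
    AffineIndependent ℝ ![p, q, r] := by
  rw [affineIndependent_iff_of_fintype]
  intro w hw hs
  rw [Finset.weightedVSub_eq_linear_combination _ hw, Fin.sum_univ_three] at hs
  rw [Fin.sum_univ_three] at hw
  have e1 := congrArg f hs
  have e2 := congrArg g hs
  simp at e1 e2
  have h0 : w 0 = - w 1 - w 2 := by linarith
  rw [h0] at e1 e2
  have h1 : w 1 = 0 := by
    apply (mul_eq_zero.mp (?_ : w 1 * ((f q - f p) * (g r - g p) - (f r - f p) * (g q - g p)) = 0)).resolve_right hd
    linear_combination (g r - g p) * e1 - (f r - f p) * e2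
  have h2 : w 2 = 0 := by
    apply (mul_eq_zero.mp (?_ : w 2 * ((f q - f p) * (g r - g p) - (f r - f p) * (g q - g p)) = 0)).resolve_right hd
    linear_combination (f q - f p) * e2 - (g q - g p) * e1
  intro i
  fin_cases i
  · simp [h0, h1, h2]
  · exact h1
  · exact h2

lemma triA {f g : Euc2 →L[ℝ] ℝ} {V W : Euc2} (h : Crd f g V W) {lam : ℝ} (h0 : 0 < lam)
    (h1 : lam < 1) :
    IsOpenTriangle {x | 0 < g x ∧ g x < f x ∧ (1 - lam) * g x < lam * (1 - f x)} := by
  have ha : AffineIndependent ℝ ![(0 : Euc2), V, lam • V + lam • W] := by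
    apply aff_indep (f := f) (g := g)
    simp [h.fV, h.fW, h.gV, h.gW, h0.ne']
  refine ⟨_, _, _, ha, ?_⟩
  rw [tri_interior _ _ _ ha]
  ext x
  simp only [mem_setOf_eq]
  constructor
  · rintro ⟨k1, k2, k3⟩
    refine ⟨1 - f x + g x - g x / lam, f x - g x, g x / lam, ?_, by linarith, by positivity, by ring, ?_⟩
    · have : g x / lam < 1 - f x + g x := by
        rw [div_lt_iff₀ h0]; linarith
      linarith
    · apply h.ext
      · simp [h.fV, h.fW, h.gV, h.gW]; field_simp; ring
      · simp [h.fV, h.fW, h.gV, h.gW]; field_simp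
  · rintro ⟨α, β, γ, k1, k2, k3, k4, rfl⟩
    simp only [map_add, map_smul, map_zero, h.fV, h.fW, h.gV, h.gW, smul_eq_mul, mul_zero, mul_one,
      zero_add, add_zero]
    have : 0 < lam * α := by positivity
    have : 0 < γ * lam := by positivity
    have : α = 1 - β - γ := by linarith
    subst this
    refine ⟨by linarith, by linarith, by nlinarith⟩

lemma triB {f g : Euc2 →L[ℝ] ℝ} {V W : Euc2} (h : Crd f g V W) {lam : ℝ} (h0 : 0 < lam)
    (h1 : lam < 1) :
    IsOpenTriangle {x | f x < 1 ∧ g x < f x ∧ lam * (1 - f x) < (1 - lam) * g x} := by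
  have h1' : 0 < 1 - lam := by linarith
  have ha : AffineIndependent ℝ ![V, V + W, lam • V + lam • W] := by
    apply aff_indep (f := f) (g := g)
    simp [h.fV, h.fW, h.gV, h.gW]
    intro h; linarith
  refine ⟨_, _, _, ha, ?_⟩
  rw [tri_interior _ _ _ ha]
  ext x
  simp only [mem_setOf_eq]
  constructor
  · rintro ⟨k1, k2, k3⟩
    refine ⟨f x - g x, g x - lam * (1 - f x) / (1 - lam), (1 - f x) / (1 - lam), by linarith, ?_, 
      div_pos (by linarith) h1', by field_simp; ring, ?_⟩
    · have : lam * (1 - f x) / (1 - lam) < g x := by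
        rw [div_lt_iff₀ h1']; linarith
      linarith
    · apply h.ext
      · simp [h.fV, h.fW, h.gV, h.gW]; field_simp; ring
      · simp [h.fV, h.fW, h.gV, h.gW]; field_simp; ring
  · rintro ⟨α, β, γ, k1, k2, k3, k4, rfl⟩
    simp only [map_add, map_smul, map_zero, h.fV, h.fW, h.gV, h.gW, smul_eq_mul, mul_zero, mul_one,
      zero_add, add_zero]
    have : 0 < (1 - lam) * β := by positivity
    have : 0 < (1 - lam) * γ := by positivity
    have : α = 1 - β - γ := by linarith
    subst this
    refine ⟨by linarith, by linarith, by nlinarith⟩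

lemma null_line (F : Euc2 →L[ℝ] ℝ) (c : ℝ) (v : Euc2) (hv : F v ≠ 0) :
    volume {x | F x = c} = 0 := by
  have hk : volume ((LinearMap.ker F.toLinearMap : Submodule ℝ Euc2) : Set Euc2) = 0 := by
    apply Measure.addHaar_submodule
    intro ht
    apply hv
    have : v ∈ LinearMap.ker F.toLinearMap := by rw [ht]; trivial
    simpa using this
  have : {x | F x = c} = (fun x => x + (-(c / F v) • v)) ⁻¹'
      ((LinearMap.ker F.toLinearMap : Submodule ℝ Euc2) : Set Euc2) := by
    ext x
    simp [hv]
    constructor <;> intro h <;> linarith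
  rw [this, measure_preimage_add_right, hk]

/-- the tent function -/
def tent (f g : Euc2 →L[ℝ] ℝ) (lam : ℝ) (x : Euc2) : ℝ :=
  min (lam * (1 - max (f x) (g x))) ((1 - lam) * min (f x) (g x))

def tentMap (M : Matrix (Fin 2) (Fin 2) ℝ) (p : Euc2) (f g : Euc2 →L[ℝ] ℝ) (lam : ℝ) (x : Euc2) :
    Euc2 := matVec2 M x + tent f g lam x • p

def matCLM (M : Matrix (Fin 2) (Fin 2) ℝ) : Euc2 →L[ℝ] Euc2 :=
  LinearMap.toContinuousLinearMap
    { toFun := matVec2 M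
      map_add' := by
        intro x y; ext i; simp [matVec2]; ring
      map_smul' := by
        intro x y; ext i; simp [matVec2]; ring }

lemma matCLM_apply (M : Matrix (Fin 2) (Fin 2) ℝ) (x : Euc2) : matCLM M x = matVec2 M x := rfl

lemma grad_of_affine {w : Euc2 → Euc2} {A : Matrix (Fin 2) (Fin 2) ℝ} {c : Euc2} {T : Set Euc2}
    (hT : IsOpen T) (h : EqOn w (fun x => matVec2 A x + c) T) {x : Euc2} (hx : x ∈ T) :
    grad2 w x = A := by
  have h1 : HasFDerivAt (fun x => matVec2 A x + c) (matCLM A) x :=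
    (matCLM A).hasFDerivAt.add_const c
  have h2 : HasFDerivAt w (matCLM A) x :=
    h1.congr_of_eventuallyEq (Filter.eventuallyEq_of_mem (hT.mem_nhds hx) h)
  ext i j
  rw [grad2, h2.fderiv, matCLM_apply]
  fin_cases j <;> simp [matVec2]

/-- `M + k p ⊗ f` -/
def upd (M : Matrix (Fin 2) (Fin 2) ℝ) (p : Euc2) (f : Euc2 →L[ℝ] ℝ) (k : ℝ) :
    Matrix (Fin 2) (Fin 2) ℝ :=
  fun i j => M i j + k * (p i * f (EuclideanSpace.single j 1))

lemma upd_apply (M : Matrix (Fin 2) (Fin 2) ℝ) (p : Euc2) (f : Euc2 →L[ℝ] ℝ) (k : ℝ) (x : Euc2) :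
    matVec2 (upd M p f k) x = matVec2 M x + (k * f x) • p := by
  have hx : f x = x 0 * f (EuclideanSpace.single 0 1) + x 1 * f (EuclideanSpace.single 1 1) := by
    have : x = x 0 • EuclideanSpace.single 0 (1 : ℝ) + x 1 • EuclideanSpace.single 1 (1 : ℝ) := by
      ext i; fin_cases i <;> simp
    conv_lhs => rw [this]
    simp
  ext i
  simp [matVec2, upd, hx]
  ring

lemma core {f g : Euc2 →L[ℝ] ℝ} {V W : Euc2} (h : Crd f g V W) {lam : ℝ} (h0 : 0 < lam)
    (h1 : lam < 1) (M : Matrix (Fin 2) (Fin 2) ℝ) (p : Euc2) (P : Matrix (Fin 2) (Fin 2) ℝ → Prop)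
    (p1 : P (upd M p f (1 - lam))) (p2 : P (upd M p g (1 - lam)))
    (p3 : P (upd M p f (-lam))) (p4 : P (upd M p g (-lam))) :
    ∃ (Ωδ : Set Euc2) (w : Euc2 → Euc2) (L : NNReal),
        IsOpenParallelogram Ωδ ∧
        LipschitzOnWith L w (closure Ωδ) ∧
        IsPiecewiseAffineOn w Ωδ ∧
        (∀ᵐ x ∂(volume : Measure Euc2), x ∈ Ωδ → P (grad2 w x)) ∧
        EqOn w (matVec2 M) (frontier Ωδ) := by
  have h1' : 0 < 1 - lam := by linarith
  set Ω : Set Euc2 := {x | 0 < f x ∧ f x < 1 ∧ 0 < g x ∧ g x < 1} with hΩ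
  set T1 : Set Euc2 := {x | 0 < g x ∧ g x < f x ∧ (1 - lam) * g x < lam * (1 - f x)} with hT1
  set T2 : Set Euc2 := {x | 0 < f x ∧ f x < g x ∧ (1 - lam) * f x < lam * (1 - g x)} with hT2
  set T3 : Set Euc2 := {x | f x < 1 ∧ g x < f x ∧ lam * (1 - f x) < (1 - lam) * g x} with hT3
  set T4 : Set Euc2 := {x | g x < 1 ∧ f x < g x ∧ lam * (1 - g x) < (1 - lam) * f x} with hT4
  have t1 : IsOpenTriangle T1 := triA h h0 h1
  have t2 : IsOpenTriangle T2 := triA h.swap h0 h1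
  have t3 : IsOpenTriangle T3 := triB h h0 h1
  have t4 : IsOpenTriangle T4 := triB h.swap h0 h1
  have op : ∀ {T}, IsOpenTriangle T → IsOpen T := by
    rintro T ⟨_, _, _, _, rfl⟩; exact isOpen_interior
  set w := tentMap M p f g lam with hw
  have e1 : EqOn w (fun x => matVec2 (upd M p g (1 - lam)) x + 0) T1 := by
    rintro x ⟨k1, k2, k3⟩
    simp only [hw, tentMap, tent, upd_apply, max_eq_left k2.le, min_eq_right k2.le, add_zero]
    rw [min_eq_right k3.le]
  have e2 : EqOn w (fun x => matVec2 (upd M p f (1 - lam)) x + 0) T2 := by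
    rintro x ⟨k1, k2, k3⟩
    simp only [hw, tentMap, tent, upd_apply, max_eq_right k2.le, min_eq_left k2.le, add_zero]
    rw [min_eq_right k3.le]
  have e3 : EqOn w (fun x => matVec2 (upd M p f (-lam)) x + lam • p) T3 := by
    rintro x ⟨k1, k2, k3⟩
    simp only [hw, tentMap, tent, upd_apply, max_eq_left k2.le, min_eq_right k2.le]
    rw [min_eq_left k3.le, add_assoc, ← add_smul]
    congr 2; ring
  have e4 : EqOn w (fun x => matVec2 (upd M p g (-lam)) x + lam • p) T4 := by
    rintro x ⟨k1, k2, k3⟩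
    simp only [hw, tentMap, tent, upd_apply, max_eq_right k2.le, min_eq_left k2.le]
    rw [min_eq_left k3.le, add_assoc, ← add_smul]
    congr 2; ring
  have s1 : T1 ⊆ Ω := by
    rintro x ⟨k1, k2, k3⟩
    have : 0 < lam * (1 - f x) := lt_trans (by positivity) k3
    have : 0 < 1 - f x := pos_of_mul_pos_right this h0.le
    exact ⟨by linarith, by linarith, k1, by linarith⟩
  have s2 : T2 ⊆ Ω := by
    rintro x ⟨k1, k2, k3⟩
    have : 0 < lam * (1 - g x) := lt_trans (by positivity) k3
    have : 0 < 1 - g x := pos_of_mul_pos_right this h0.le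
    exact ⟨by linarith, by linarith, by linarith, by linarith⟩
  have s3 : T3 ⊆ Ω := by
    rintro x ⟨k1, k2, k3⟩
    have : 0 < 1 - f x := by linarith
    have : 0 < (1 - lam) * g x := lt_trans (by positivity) k3
    have : 0 < g x := pos_of_mul_pos_right this h1'.le
    exact ⟨by linarith, by linarith, by linarith, by linarith⟩
  have s4 : T4 ⊆ Ω := by
    rintro x ⟨k1, k2, k3⟩
    have : 0 < 1 - g x := by linarith
    have : 0 < (1 - lam) * f x := lt_trans (by positivity) k3
    have : 0 < f x := pos_of_mul_pos_right this h1'.le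
    exact ⟨by linarith, by linarith, by linarith, by linarith⟩
  have hnull : volume (Ω \ (T1 ∪ T2 ∪ T3 ∪ T4)) = 0 := by
    have n1 := null_line (f - g) 0 V (by simp [h.fV, h.gV])
    have n2 := null_line ((1 - lam) • g + lam • f) lam V (by simp [h.fV, h.gV, h0.ne'])
    have n3 := null_line ((1 - lam) • f + lam • g) lam W (by simp [h.fW, h.gW, h0.ne'])
    refine measure_mono_null ?_ (measure_union_null (measure_union_null n1 n2) n3)
    rintro x ⟨⟨k1, k2, k3, k4⟩, hx⟩
    by_contra hc
    apply hx
    simp only [mem_union, mem_setOf_eq, not_or, ContinuousLinearMap.sub_apply,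
      ContinuousLinearMap.add_apply, ContinuousLinearMap.smul_apply, smul_eq_mul] at hc
    obtain ⟨⟨c1, c2⟩, c3⟩ := hc
    simp only [mem_union, hT1, hT2, hT3, hT4, mem_setOf_eq]
    rcases lt_or_gt_of_ne c1 with c1 | c1 <;> rcases lt_or_gt_of_ne c2 with c2 | c2 <;>
      rcases lt_or_gt_of_ne c3 with c3 | c3
    · exact Or.inl (Or.inl (Or.inr ⟨k1, by linarith, by linarith⟩))
    · exact Or.inr ⟨k4, by linarith, by linarith⟩
    · exact Or.inl (Or.inl (Or.inr ⟨k1, by linarith, by linarith⟩))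
    · exact Or.inr ⟨k4, by linarith, by linarith⟩
    · exact Or.inl (Or.inl (Or.inl ⟨k3, by linarith, by linarith⟩))
    · exact Or.inl (Or.inl (Or.inl ⟨k3, by linarith, by linarith⟩))
    · exact Or.inl (Or.inr ⟨k2, by linarith, by linarith⟩)
    · exact Or.inl (Or.inr ⟨k2, by linarith, by linarith⟩)
  have hlip : ∃ L : NNReal, LipschitzWith L w := by
    have a1 := (LipschitzWith.const (α := Euc2) (1 : ℝ)).sub (f.lipschitz.max g.lipschitz)
    have a2 := ((lam • ContinuousLinearMap.id ℝ ℝ : ℝ →L[ℝ] ℝ).lipschitz.comp a1)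
    have a3 := (((1 - lam) • ContinuousLinearMap.id ℝ ℝ : ℝ →L[ℝ] ℝ).lipschitz.comp
      (f.lipschitz.min g.lipschitz))
    have a4 := ((ContinuousLinearMap.toSpanSingleton ℝ p).lipschitz.comp (a2.min a3))
    exact ⟨_, (matCLM M).lipschitz.add a4⟩
  obtain ⟨L, hL⟩ := hlip
  refine ⟨Ω, w, L, ?_, hL.lipschitzOnWith, ?_, ?_, ?_⟩
  · refine ⟨0, V, W, ?_, ?_⟩
    · rw [LinearIndependent.pair_iff]
      intro s t hst
      have u1 := congrArg f hst
      have u2 := congrArg g hst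
      simp [h.fV, h.fW, h.gV, h.gW] at u1 u2
      exact ⟨u1, u2⟩
    · ext x
      constructor
      · rintro ⟨k1, k2, k3, k4⟩
        exact ⟨f x, ⟨k1, k2⟩, g x, ⟨k3, k4⟩, by rw [zero_add]; exact h.rep x⟩
      · rintro ⟨a, ⟨k1, k2⟩, b, ⟨k3, k4⟩, rfl⟩
        simp [hΩ, h.fV, h.fW, h.gV, h.gW, *]
  · refine ⟨4, ![T1, T2, T3, T4], ?_, ?_, ?_, ?_, ?_⟩
    · intro k; fin_cases k <;> assumption
    · intro k; fin_cases k <;> assumption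
    · intro k l hkl
      rw [Set.eq_empty_iff_forall_notMem]
      rintro x ⟨hk, hl⟩
      fin_cases k <;> fin_cases l <;> first
        | exact hkl rfl
        | (simp [hT1, hT2, hT3, hT4] at hk hl
           linarith [hk.1, hk.2.1, hk.2.2, hl.1, hl.2.1, hl.2.2])
    · convert hnull using 3
      ext x
      simp [Fin.exists_fin_succ, or_assoc]
    · intro k
      fin_cases k
      · exact ⟨_, _, e1⟩
      · exact ⟨_, _, e2⟩
      · exact ⟨_, _, e3⟩
      · exact ⟨_, _, e4⟩
  · have := measure_eq_zero_iff_ae_notMem.mp hnull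
    filter_upwards [this] with x hx hxΩ
    have hx' : x ∈ T1 ∪ T2 ∪ T3 ∪ T4 := by
      by_contra hc; exact hx ⟨hxΩ, hc⟩
    rcases hx' with ((hx' | hx') | hx') | hx'
    · rw [grad_of_affine (op t1) e1 hx']; exact p2
    · rw [grad_of_affine (op t2) e2 hx']; exact p1
    · rw [grad_of_affine (op t3) e3 hx']; exact p3
    · rw [grad_of_affine (op t4) e4 hx']; exact p4
  · intro x hx
    have hopen : IsOpen Ω := by
      simp only [hΩ, setOf_and]
      refine (isOpen_lt ?_ ?_).inter ((isOpen_lt ?_ ?_).inter ((isOpen_lt ?_ ?_).inter (isOpen_lt ?_ ?_))) <;> fun_prop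
    rw [hopen.frontier_eq] at hx
    obtain ⟨hc, hn⟩ := hx
    have hcl : IsClosed {x | 0 ≤ f x ∧ f x ≤ 1 ∧ 0 ≤ g x ∧ g x ≤ 1} := by
      simp only [setOf_and]
      refine (isClosed_le ?_ ?_).inter ((isClosed_le ?_ ?_).inter ((isClosed_le ?_ ?_).inter (isClosed_le ?_ ?_))) <;> fun_prop
    have hc' := closure_minimal (s := Ω) (t := {x | 0 ≤ f x ∧ f x ≤ 1 ∧ 0 ≤ g x ∧ g x ≤ 1})
      (fun x ⟨k1, k2, k3, k4⟩ => ⟨k1.le, k2.le, k3.le, k4.le⟩) hcl hc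
    obtain ⟨k1, k2, k3, k4⟩ := hc'
    have ht : tent f g lam x = 0 := by
      have m1 : max (f x) (g x) ≤ 1 := max_le k2 k4
      have m2 : 0 ≤ min (f x) (g x) := le_min k1 k3
      have a1 : 0 ≤ lam * (1 - max (f x) (g x)) := mul_nonneg h0.le (by linarith)
      have a2 : 0 ≤ (1 - lam) * min (f x) (g x) := mul_nonneg h1'.le m2
      have : max (f x) (g x) = 1 ∨ min (f x) (g x) = 0 := by
        by_contra hcon
        push Not at hcon
        apply hn
        have m3 := lt_of_le_of_ne m1 hcon.1
        have m4 := lt_of_le_of_ne m2 hcon.2.symm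
        rw [max_lt_iff] at m3
        rw [lt_min_iff] at m4
        exact ⟨m4.1, m3.1, m4.2, m3.2⟩
      rcases this with h | h
      · rw [tent, h, sub_self, mul_zero] at *
        exact min_eq_left a2
      · rw [tent, h, mul_zero] at *
        exact min_eq_right a1
    simp [hw, tentMap, ht]

/-- symmetrized rank-one factorization of trace-free symmetric matrices -/
lemma factor (a b : ℝ) : ∃ p1 p2 n1 n2 : ℝ, 0 < n1 ^ 2 + n2 ^ 2 ∧ p1 * n1 = a ∧ p2 * n2 = -a ∧
    p1 * n2 + p2 * n1 = 2 * b := by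
  by_cases ha : a = 0
  · exact ⟨2 * b, 0, 0, 1, by norm_num, by simp [ha], by simp [ha], by ring⟩
  · have hr := Real.sq_sqrt (by positivity : 0 ≤ a ^ 2 + b ^ 2)
    set r := Real.sqrt (a ^ 2 + b ^ 2)
    refine ⟨a, b + r, 1, (b - r) / a, by positivity, by ring, ?_, ?_⟩
    · field_simp; linarith
    · field_simp; ring

def covec (a b : ℝ) : Euc2 →L[ℝ] ℝ := a • EuclideanSpace.proj 0 + b • EuclideanSpace.proj 1

lemma covec_apply (a b : ℝ) (x : Euc2) : covec a b x = a * x 0 + b * x 1 := by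
  simp [covec]

lemma crd_of_det (a b c d : ℝ) (h : a * d - b * c ≠ 0) :
    ∃ V W, Crd (covec a b) (covec c d) V W := by
  refine ⟨!₂[d / (a * d - b * c), -c / (a * d - b * c)], !₂[-b / (a * d - b * c), a / (a * d - b * c)],
    ?_, ?_, ?_, ?_, ?_⟩
  · simp [covec_apply]; field_simp; ring
  · simp [covec_apply]; field_simp; ring
  · simp [covec_apply]; field_simp; ring
  · simp only [covec_apply, PiLp.toLp_apply, Matrix.cons_val_zero, Matrix.cons_val_one]
    rw [← mul_div_assoc, ← mul_div_assoc, ← add_div, div_eq_one_iff_eq h]; ring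
  · intro x
    ext i
    fin_cases i <;> simp [covec_apply] <;> field_simp <;> ring

lemma distK2_le (A : Matrix (Fin 2) (Fin 2) ℝ) (i : Fin 3) :
    distK2 A hexK ≤ fro2 (A - hexWells i) := by
  apply csInf_le
  · refine ⟨0, ?_⟩
    rintro _ ⟨B, _, rfl⟩
    exact Real.sqrt_nonneg _
  · refine ⟨hexWells i, ?_, rfl⟩
    fin_cases i <;> simp [hexK]

lemma le_distK2 (A : Matrix (Fin 2) (Fin 2) ℝ) (c : ℝ) (h : ∀ i, c ≤ fro2 (A - hexWells i)) :
    c ≤ distK2 A hexK := by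
  apply le_csInf
  · exact ⟨_, hexWells 0, by simp [hexK], rfl⟩
  · rintro _ ⟨B, hB, rfl⟩
    rcases hB with rfl | rfl | rfl <;> exact h _

lemma fro2_comb {i j k : Fin 3} (hij : i ≠ j) (hik : i ≠ k) (hjk : j ≠ k) (α β γ : ℝ) :
    fro2 (α • hexWells i + β • hexWells j + γ • hexWells k) =
      Real.sqrt (2 * (α ^ 2 + β ^ 2 + γ ^ 2 - α * β - β * γ - α * γ)) := by
  have h3 : Real.sqrt 3 ^ 2 = 3 := Real.sq_sqrt (by norm_num)
  rw [fro2]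
  congr 1
  simp only [Fin.sum_univ_two]
  fin_cases i <;> fin_cases j <;> fin_cases k <;> first
    | exact absurd rfl hij
    | exact absurd rfl hik
    | exact absurd rfl hjk
    | (simp [hexWells]
       ring_nf
       simp only [h3]
       ring)

lemma hex_shape (i : Fin 3) : hexWells i 1 0 = hexWells i 0 1 ∧ hexWells i 1 1 = - hexWells i 0 0 := by
  fin_cases i <;> simp [hexWells]

lemma sum_perm {i j k : Fin 3} (hij : i ≠ j) (hik : i ≠ k) (hjk : j ≠ k) {E : Type*}
    [AddCommMonoid E] (F : Fin 3 → E) : ∑ l, F l = F i + F j + F k := by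
  rw [Fin.sum_univ_three]
  fin_cases i <;> fin_cases j <;> fin_cases k <;> first
    | exact absurd rfl hij
    | exact absurd rfl hik
    | exact absurd rfl hjk
    | (simp; try abel)

lemma key_ineq {x y z : ℝ} (hz : 0 < z) (hzy : z ≤ y) (hyx : y ≤ x) (hs : x + y + z = 1) :
    (z / (x + z)) ^ 2 ≤ 3 / 4 * (y ^ 2 + y * z + z ^ 2) := by
  have hxz : 0 < x + z := by linarith
  have hyz : 0 < y + z := by linarith
  have h1 : z / (x + z) ≤ z * (2 * y + z) / (y + z) := by
    rw [div_le_div_iff₀ hxz hyz]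
    have : y + z ≤ (2 * y + z) * (x + z) := by
      have : y + z = (y + z) * (x + y + z) := by rw [hs, mul_one]
      nlinarith
    nlinarith
  have h2 : (z / (x + z)) ^ 2 ≤ (z * (2 * y + z) / (y + z)) ^ 2 :=
    pow_le_pow_left₀ (by positivity) h1 2
  refine h2.trans ?_
  rw [div_pow, div_le_iff₀ (by positivity)]
  obtain ⟨d, hd, rfl⟩ : ∃ d, 0 ≤ d ∧ y = z + d := ⟨y - z, by linarith, by ring⟩
  have : 0 ≤ 3 / 4 * ((z + d) ^ 2 + (z + d) * z + z ^ 2) * (z + d + z) ^ 2 -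
      (z * (2 * (z + d) + z)) ^ 2 := by
    ring_nf
    positivity
  linarith

lemma sym_upd (M : Matrix (Fin 2) (Fin 2) ℝ) (p1 p2 n1 n2 k : ℝ) (S : Matrix (Fin 2) (Fin 2) ℝ)
    (h00 : p1 * n1 = S 0 0) (h11 : p2 * n2 = S 1 1) (h01 : p1 * n2 + p2 * n1 = 2 * S 0 1)
    (h10 : S 1 0 = S 0 1) :
    symPart (upd M !₂[p1, p2] (covec n1 n2) k) = symPart M + k • S := by
  ext i j
  fin_cases i <;> fin_cases j
  · simp [symPart, upd, covec_apply]
    linear_combination k * h00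
  · simp [symPart, upd, covec_apply]
    linear_combination k / 2 * h01
  · simp [symPart, upd, covec_apply]
    linear_combination k / 2 * h01 - k * h10
  · simp [symPart, upd, covec_apply]
    linear_combination k * h11

lemma cont_upd (M B : Matrix (Fin 2) (Fin 2) ℝ) (p : Euc2) (n1 n2 k : ℝ) :
    Continuous fun t : ℝ =>
      fro2 (symPart (upd M p (covec (n1 - t * n2) (n2 + t * n1)) k) - B) := by
  simp only [fro2, symPart, upd, covec_apply, Fin.sum_univ_two, Matrix.sub_apply, Matrix.smul_apply,
    Matrix.add_apply, Matrix.transpose_apply, smul_eq_mul]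
  fun_prop

lemma main_step {i j k : Fin 3} (hij : i ≠ j) (hik : i ≠ k) (hjk : j ≠ k) {x y z : ℝ} (hz : 0 < z)
    (hzy : z ≤ y) (hyx : y ≤ x) (hs : x + y + z = 1) (M : Matrix (Fin 2) (Fin 2) ℝ)
    (hM : symPart M = x • hexWells i + y • hexWells j + z • hexWells k) :
      ∃ (Ωδ : Set Euc2) (w : Euc2 → Euc2) (L : NNReal),
        IsOpenParallelogram Ωδ ∧
        LipschitzOnWith L w (closure Ωδ) ∧
        IsPiecewiseAffineOn w Ωδ ∧
        (∀ᵐ x ∂(volume : Measure Euc2), x ∈ Ωδ →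
          distK2 (symPart (grad2 w x)) hexK ≤ 19 / 20 * distK2 (symPart M) hexK) ∧
        EqOn w (matVec2 M) (frontier Ωδ) := by
  have hy : 0 < y := by linarith
  have hx : 0 < x := by linarith
  have hxz : 0 < x + z := by linarith
  set q := y ^ 2 + y * z + z ^ 2 with hq
  have hqpos : 0 < q := by positivity
  set d0 := distK2 (symPart M) hexK with hd0
  have hd : Real.sqrt (6 * q) ≤ d0 := by
    apply le_distK2
    intro l
    have hl : l = i ∨ l = j ∨ l = k := by
      revert hij hik hjk; clear * -; revert i j k l; decide
    have hx' : x = 1 - y - z := by linarith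
    rw [hM]
    rcases hl with rfl | rfl | rfl
    · have e : x • hexWells l + y • hexWells j + z • hexWells k - hexWells l =
        (x - 1) • hexWells l + y • hexWells j + z • hexWells k := by module
      rw [e, fro2_comb hij hik hjk]
      apply Real.sqrt_le_sqrt
      rw [hx', hq]; apply le_of_eq; ring
    · have e : x • hexWells i + y • hexWells l + z • hexWells k - hexWells l =
        x • hexWells i + (y - 1) • hexWells l + z • hexWells k := by module
      rw [e, fro2_comb hij hik hjk]
      apply Real.sqrt_le_sqrt
      have : y - 1 = -x - z := by linarith
      rw [this, hq]; nlinarith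
    · have e : x • hexWells i + y • hexWells j + z • hexWells l - hexWells l =
        x • hexWells i + y • hexWells j + (z - 1) • hexWells l := by module
      rw [e, fro2_comb hij hik hjk]
      apply Real.sqrt_le_sqrt
      have : z - 1 = -x - y := by linarith
      rw [this, hq]; nlinarith
  have hd0pos : 0 < d0 := lt_of_lt_of_le (Real.sqrt_pos.mpr (by positivity)) hd
  set s := x + z with hsdef
  have hs1 : s < 1 := by linarith
  set A : Matrix (Fin 2) (Fin 2) ℝ := (x / s) • hexWells i + (z / s) • hexWells k with hA
  set S := A - hexWells j with hS
  have hA1 : symPart M + (1 - s) • S = A := by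
    have hys : y = 1 - s := by linarith
    rw [hM, hS, hA, hys]
    match_scalars <;> field_simp <;> ring
  have hA2 : symPart M + (-s) • S = hexWells j := by
    have hys : y = 1 - s := by linarith
    rw [hM, hS, hA, hys]
    match_scalars <;> field_simp <;> ring
  have hAi : fro2 (A - hexWells i) < 19 / 20 * d0 := by
    have e : A - hexWells i = (-(z / s)) • hexWells i + (0 : ℝ) • hexWells j + (z / s) • hexWells k := by
      have : x = s - z := by rw [hsdef]; ring
      rw [hA, this]
      match_scalars <;> field_simp <;> ring
    rw [e, fro2_comb hij hik hjk]
    have h1 : 19 / 20 * Real.sqrt (6 * q) ≤ 19 / 20 * d0 := by linarith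
    refine lt_of_lt_of_le ?_ h1
    have h2 : (19 / 20 : ℝ) = Real.sqrt ((19 / 20) ^ 2) := by
      rw [Real.sqrt_sq]; norm_num
    rw [h2, ← Real.sqrt_mul (by positivity)]
    apply Real.sqrt_lt_sqrt
    · nlinarith [sq_nonneg (z / s)]
    · have := key_ineq hz hzy hyx hs
      rw [← hsdef, ← hq] at this
      nlinarith
  obtain ⟨p1, p2, n1, n2, hn, f00, f11, f01⟩ := factor (S 0 0) (S 0 1)
  have hsh : S 1 0 = S 0 1 ∧ S 1 1 = - S 0 0 := by
    simp only [hS, hA, Matrix.sub_apply, Matrix.add_apply, Matrix.smul_apply, smul_eq_mul,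
      (hex_shape i).1, (hex_shape i).2, (hex_shape j).1, (hex_shape j).2, (hex_shape k).1,
      (hex_shape k).2]
    constructor
    · trivial
    · ring
  rw [← hsh.2] at f11
  have hupd := fun κ => sym_upd M p1 p2 n1 n2 κ S f00 f11 f01 hsh.1
  have c1 : ∀ᶠ t in nhds (0 : ℝ), fro2 (symPart (upd M !₂[p1, p2]
      (covec (n1 - t * n2) (n2 + t * n1)) (1 - s)) - hexWells i) < 19 / 20 * d0 := by
    apply (cont_upd M (hexWells i) !₂[p1, p2] n1 n2 (1 - s)).continuousAt.eventually_lt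
      continuousAt_const
    simp only [zero_mul, sub_zero, add_zero]
    rw [hupd, hA1]
    exact hAi
  have c2 : ∀ᶠ t in nhds (0 : ℝ), fro2 (symPart (upd M !₂[p1, p2]
      (covec (n1 - t * n2) (n2 + t * n1)) (-s)) - hexWells j) < 19 / 20 * d0 := by
    apply (cont_upd M (hexWells j) !₂[p1, p2] n1 n2 (-s)).continuousAt.eventually_lt
      continuousAt_const
    simp only [zero_mul, sub_zero, add_zero]
    rw [hupd, hA2]
    simp [fro2]
    exact hd0pos
  obtain ⟨δ, hδ, hball⟩ := Metric.eventually_nhds_iff.mp (c1.and c2)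
  have hp := @hball (δ / 2) (by rw [Real.dist_eq, sub_zero, abs_of_pos (by positivity)]; linarith)
  have hm := @hball (-(δ / 2)) (by
    rw [Real.dist_eq, sub_zero, abs_neg, abs_of_pos (by positivity)]; linarith)
  obtain ⟨V, W, hc⟩ := crd_of_det (n1 - δ / 2 * n2) (n2 + δ / 2 * n1) (n1 - -(δ / 2) * n2)
    (n2 + -(δ / 2) * n1) (by
      have : 0 < δ * (n1 ^ 2 + n2 ^ 2) := by positivity
      intro h0
      linarith)
  exact core hc hxz hs1 M !₂[p1, p2] (fun G => distK2 (symPart G) hexK ≤ 19 / 20 * d0)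
    ((distK2_le _ i).trans hp.1.le) ((distK2_le _ i).trans hm.1.le)
    ((distK2_le _ j).trans hp.2.le) ((distK2_le _ j).trans hm.2.le)

/-- The replacement construction from [RZZ17]: there is a universal
`γ ∈ (0,1)` such that for every `M` with `e(M)` in the relative interior of `conv(K)`
there are a diamond-shaped (parallelogram) domain `Ω_δ(M)` and a piecewise affine
Lipschitz map `w` with `dist(e(∇w), K) ≤ γ · dist(e(M), K)` a.e. in `Ω_δ(M)` and
`w = Mx` on `∂Ω_δ(M)`. -/
theorem statement8 :
    ∃ γ ∈ Set.Ioo (0:ℝ) 1, ∀ M : Matrix (Fin 2) (Fin 2) ℝ, inIntConv (symPart M) →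
      ∃ (Ωδ : Set Euc2) (w : Euc2 → Euc2) (L : NNReal),
        IsOpenParallelogram Ωδ ∧
        LipschitzOnWith L w (closure Ωδ) ∧
        IsPiecewiseAffineOn w Ωδ ∧
        (∀ᵐ x ∂(volume : Measure Euc2), x ∈ Ωδ →
          distK2 (symPart (grad2 w x)) hexK ≤ γ * distK2 (symPart M) hexK) ∧
        EqOn w (matVec2 M) (frontier Ωδ) := by
  refine ⟨19 / 20, ⟨by norm_num, by norm_num⟩, ?_⟩
  rintro M ⟨lam, hpos, hsum, hM⟩
  have fin : ∀ i j k : Fin 3, i ≠ j → i ≠ k → j ≠ k → lam k ≤ lam j → lam j ≤ lam i → _ :=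
    fun i j k hij hik hjk h1 h2 => main_step hij hik hjk (hpos k) h1 h2
      (by rw [← hsum, sum_perm hij hik hjk]) M (by rw [hM, sum_perm hij hik hjk])
  rcases le_total (lam 0) (lam 1) with h01 | h01 <;> rcases le_total (lam 0) (lam 2) with h02 | h02 <;>
    rcases le_total (lam 1) (lam 2) with h12 | h12
  · exact fin 2 1 0 (by decide) (by decide) (by decide) h01 h12
  · exact fin 1 2 0 (by decide) (by decide) (by decide) h02 h12
  · exact fin 2 1 0 (by decide) (by decide) (by decide) h01 h12
  · exact fin 1 0 2 (by decide) (by decide) (by decide) h02 h01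
  · exact fin 2 0 1 (by decide) (by decide) (by decide) h01 h02
  · exact fin 2 0 1 (by decide) (by decide) (by decide) h01 h02
  · exact fin 0 2 1 (by decide) (by decide) (by decide) h12 h02
  · exact fin 0 1 2 (by decide) (by decide) (by decide) h12 h01
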